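/- Let X be a metric space with Borel σ-algebra Σ, let n ∈ ℕ, let a₁,…,aₙ ∈ [0,1] with Σ_{k=1}^n a_k = 1, and let μ₁,…,μₙ be Borel probability measures on X. Then the upper entropy dimension satisfies udim_E(Σ_{k=1}^n a_k μ_k) ≤ Σ_{k=1}^n a_k udim_E(μ_k). -/

import Mathlib

open MeasureTheory ENNReal

/-- The Shannon function `sh(x) = -x·log₂ x` (with `sh 0 = 0`). -/
noncomputable def sh (x : ℝ) : ℝ := -(x * Real.logb 2 x)

/-- `P` is a `μ`-partition of `X`: a countable family of pairwise disjoint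
measurable sets covering `X` up to a `μ`-null set. -/
def IsMuPartition {X : Type*} [MeasurableSpace X] (μ : Measure X) (P : Set (Set X)) : Prop :=
  P.Countable ∧ (∀ s ∈ P, MeasurableSet s) ∧ P.Pairwise Disjoint ∧ μ (⋃₀ P)ᶜ = 0

/-- The `μ`-entropy `h(μ;P) = Σ_{P∈P} sh(μ(P))` of a family of sets. -/
noncomputable def partEntropy {X : Type*} [MeasurableSpace X] (μ : Measure X)
    (P : Set (Set X)) : ℝ≥0∞ :=
  ∑' s : P, ENNReal.ofReal (sh (μ s).toReal)

/-- `P ≺ Q` : every element of `P` is contained in some element of `Q`. -/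
def Finer {X : Type*} (P Q : Set (Set X)) : Prop := ∀ p ∈ P, ∃ q ∈ Q, p ⊆ q

/-- The (classical) `μ`-entropy of a family `Q`:
`H(μ;Q) = inf { h(μ;P) : P a μ-partition, P ≺ Q }`, with `inf ∅ = ∞`. -/
noncomputable def entropyH {X : Type*} [MeasurableSpace X] (μ : Measure X)
    (Q : Set (Set X)) : ℝ≥0∞ :=
  ⨅ (P : Set (Set X)) (_ : IsMuPartition μ P) (_ : Finer P Q), partEntropy μ P

/-- `m ∈ V(μ;Q)` : a weighting of `Q`, i.e. `m : Q → Measure X` with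
`m_Q(X \ Q) = 0` for all `Q ∈ Q` and `Σ_{Q∈Q} m_Q = μ`. -/
def IsWeighting {X : Type*} [MeasurableSpace X] (μ : Measure X) (Q : Set (Set X))
    (m : Q → Measure X) : Prop :=
  (∀ q : Q, m q ((q : Set X))ᶜ = 0) ∧ Measure.sum m = μ

/-- The weighted `μ`-entropy of `m ∈ V(μ;Q)` : `hv(μ;m) = Σ_{Q∈Q} sh(m_Q(X))`. -/
noncomputable def wEntropy {X : Type*} [MeasurableSpace X] (Q : Set (Set X))
    (m : Q → Measure X) : ℝ≥0∞ :=
  ∑' q : Q, ENNReal.ofReal (sh ((m q) Set.univ).toReal)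

/-- The weighted `μ`-entropy of `Q` : `Hv(μ;Q) = inf { hv(μ;m) : m ∈ V(μ;Q) }`,
with `inf ∅ = ∞`. -/
noncomputable def entropyHv {X : Type*} [MeasurableSpace X] (μ : Measure X)
    (Q : Set (Set X)) : ℝ≥0∞ :=
  ⨅ (m : Q → Measure X) (_ : IsWeighting μ Q m), wEntropy Q m

/-- The family of all closed balls of radius `δ`. -/
def ballFam (X : Type*) [PseudoMetricSpace X] (δ : ℝ) : Set (Set X) :=
  Set.range (fun x : X => Metric.closedBall x δ)

/-- The lower entropy dimension `liminf_{δ→0⁺} H(μ;B_δ)/(-log₂ δ)`. -/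
noncomputable def ldimE {X : Type*} [PseudoMetricSpace X] [MeasurableSpace X]
    (μ : Measure X) : ℝ≥0∞ :=
  Filter.liminf (fun δ : ℝ => entropyH μ (ballFam X δ) / ENNReal.ofReal (-Real.logb 2 δ))
    (nhdsWithin 0 (Set.Ioi 0))

/-- The upper entropy dimension `limsup_{δ→0⁺} H(μ;B_δ)/(-log₂ δ)`. -/
noncomputable def udimE {X : Type*} [PseudoMetricSpace X] [MeasurableSpace X]
    (μ : Measure X) : ℝ≥0∞ :=
  Filter.limsup (fun δ : ℝ => entropyH μ (ballFam X δ) / ENNReal.ofReal (-Real.logb 2 δ))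
    (nhdsWithin 0 (Set.Ioi 0))

/-- `N_δ(S)` : the smallest number of closed balls of radius `δ` needed to cover `S`. -/
noncomputable def coverNum {X : Type*} [PseudoMetricSpace X] (S : Set X) (δ : ℝ) : ℝ≥0∞ :=
  ⨅ (t : Finset X) (_ : S ⊆ ⋃ x ∈ t, Metric.closedBall x δ), (t.card : ℝ≥0∞)

/-- The natural logarithm on `ℝ≥0∞` (with `log ∞ = ∞`), truncated to `ℝ≥0∞`. -/
noncomputable def logENN (x : ℝ≥0∞) : ℝ≥0∞ :=
  if x = ⊤ then ⊤ else ENNReal.ofReal (Real.log x.toReal)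

/-- The upper box dimension `limsup_{δ→0⁺} log N_δ(S)/(-log δ)`. -/
noncomputable def ubdimB {X : Type*} [PseudoMetricSpace X] (S : Set X) : ℝ≥0∞ :=
  Filter.limsup (fun δ : ℝ => logENN (coverNum S δ) / ENNReal.ofReal (-Real.log δ))
    (nhdsWithin 0 (Set.Ioi 0))

/-- The upper local dimension `D̄_μ(x) = limsup_{δ→0⁺} log μ(B(x,δ))/log δ`
(interpreted as `∞` when `μ(B(x,δ)) = 0`). -/
noncomputable def upLocalDim {X : Type*} [PseudoMetricSpace X] [MeasurableSpace X]
    (μ : Measure X) (x : X) : ℝ≥0∞ :=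
  Filter.limsup
    (fun δ : ℝ => if μ (Metric.closedBall x δ) = 0 then ⊤ else
      ENNReal.ofReal (Real.log (μ (Metric.closedBall x δ)).toReal / Real.log δ))
    (nhdsWithin 0 (Set.Ioi 0))

theorem sh_nonneg {x : ℝ} (h0 : 0 ≤ x) (h1 : x ≤ 1) : 0 ≤ sh x := by
  have := Real.logb_nonpos one_lt_two h0 h1
  unfold sh
  nlinarith

theorem sh_mul (x y : ℝ) : sh (x * y) = x * sh y + sh x * y := by
  unfold sh
  rcases eq_or_ne x 0 with rfl | hx
  · simp
  rcases eq_or_ne y 0 with rfl | hy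
  · simp
  rw [Real.logb_mul hx hy]
  ring

/-- The information content `-log₂ w` of a weight `w`, equal to `∞` at `w = 0`. -/
noncomputable def infoContent (w : ℝ≥0∞) : ℝ≥0∞ :=
  if w = 0 then ⊤ else ENNReal.ofReal (-Real.logb 2 w.toReal)

theorem infoContent_mul_self {w : ℝ≥0∞} (hw : w ≠ ⊤) :
    infoContent w * w = ENNReal.ofReal (sh w.toReal) := by
  rcases eq_or_ne w 0 with rfl | h0
  · simp [sh]
  · rw [infoContent, if_neg h0]
    nth_rw 2 [← ENNReal.ofReal_toReal hw]
    rw [← ENNReal.ofReal_mul' ENNReal.toReal_nonneg, sh]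
    congr 1
    ring

/-- The pointwise form of Gibbs' inequality. -/
theorem ofReal_sh_add_le {p w : ℝ≥0∞} (hp : p ≤ 1) (hw : w ≤ 1) :
    ENNReal.ofReal (sh p.toReal) + ENNReal.ofReal (Real.log 2)⁻¹ * p ≤
      infoContent w * p + ENNReal.ofReal (Real.log 2)⁻¹ * w := by
  have hp' : p ≠ ⊤ := ne_top_of_le_ne_top ENNReal.one_ne_top hp
  have hw' : w ≠ ⊤ := ne_top_of_le_ne_top ENNReal.one_ne_top hw
  rcases eq_or_ne p 0 with rfl | hp0
  · simp [sh]
  rcases eq_or_ne w 0 with rfl | hw0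
  · simp [infoContent, ENNReal.top_mul hp0]
  rw [infoContent, if_neg hw0]
  have hpr : 0 < p.toReal := ENNReal.toReal_pos hp0 hp'
  have hwr : 0 < w.toReal := ENNReal.toReal_pos hw0 hw'
  have hp1 : p.toReal ≤ 1 := ENNReal.toReal_mono ENNReal.one_ne_top hp
  have hw1 : w.toReal ≤ 1 := ENNReal.toReal_mono ENNReal.one_ne_top hw
  have hl : 0 < Real.log 2 := Real.log_pos one_lt_two
  have hl' : 0 < (Real.log 2)⁻¹ := inv_pos.2 hl
  have hlw : 0 ≤ -Real.logb 2 w.toReal := by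
    have := Real.logb_nonpos one_lt_two hwr.le hw1
    linarith
  have key : sh p.toReal + (Real.log 2)⁻¹ * p.toReal ≤
      -Real.logb 2 w.toReal * p.toReal + (Real.log 2)⁻¹ * w.toReal := by
    have h := Real.log_le_sub_one_of_pos (div_pos hwr hpr)
    rw [Real.log_div hwr.ne' hpr.ne'] at h
    have h2 : p.toReal * (Real.log w.toReal - Real.log p.toReal) ≤ w.toReal - p.toReal := by
      refine (mul_le_mul_of_nonneg_left h hpr.le).trans_eq ?_
      field_simp
    have h3 := mul_le_mul_of_nonneg_left h2 hl'.le
    simp only [sh, Real.logb, div_eq_mul_inv]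
    linarith
  have key' := ENNReal.ofReal_le_ofReal key
  rw [ENNReal.ofReal_add (sh_nonneg hpr.le hp1) (by positivity),
    ENNReal.ofReal_add (by positivity) (by positivity), ENNReal.ofReal_mul hl'.le,
    ENNReal.ofReal_mul hlw, ENNReal.ofReal_mul hl'.le, ENNReal.ofReal_toReal hp',
    ENNReal.ofReal_toReal hw'] at key'
  exact key'

/-- Gibbs' inequality: the entropy of a probability vector is at most its cross entropy relative
to a subprobability vector. -/
theorem tsum_ofReal_sh_le {ι : Type*} {p w : ι → ℝ≥0∞} (hp : ∑' i, p i = 1)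
    (hw : ∑' i, w i ≤ 1) :
    ∑' i, ENNReal.ofReal (sh (p i).toReal) ≤ ∑' i, infoContent (w i) * p i := by
  have h := ENNReal.tsum_le_tsum fun i =>
    ofReal_sh_add_le ((ENNReal.le_tsum i).trans_eq hp) ((ENNReal.le_tsum i).trans hw)
  rw [ENNReal.tsum_add, ENNReal.tsum_add, ENNReal.tsum_mul_left, ENNReal.tsum_mul_left, hp] at h
  exact (ENNReal.add_le_add_iff_right (by finiteness)).1 (h.trans (by gcongr))

section Mixture

variable {X : Type*} [MeasurableSpace X]

/-- The information content at a point `x` of the member of `P` containing it, equal to `∞`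
outside of `⋃₀ P`. -/
noncomputable def partInfo (ν : Measure X) (P : Set (Set X)) (x : X) : ℝ≥0∞ :=
  ⨅ s : P, (s : Set X).indicator (fun _ => infoContent (ν s)) x + (s : Set X)ᶜ.indicator ⊤ x

theorem partInfo_of_mem {ν : Measure X} {P : Set (Set X)} (hP : P.Pairwise Disjoint)
    {s : Set X} (hs : s ∈ P) {x : X} (hx : x ∈ s) : partInfo ν P x = infoContent (ν s) := by
  apply le_antisymm
  · refine (iInf_le _ ⟨s, hs⟩).trans ?_
    simp [hx]
  · refine le_iInf fun t => ?_
    by_cases hxt : x ∈ (t : Set X)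
    · have : s = t := hP.eq hs t.2 (Set.not_disjoint_iff.2 ⟨x, hx, hxt⟩)
      simp [← this, hx]
    · simp [hxt]

theorem partInfo_of_notMem {ν : Measure X} {P : Set (Set X)} {x : X} (hx : x ∉ ⋃₀ P) :
    partInfo ν P x = ⊤ := by
  refine iInf_eq_top.2 fun t => ?_
  have hxt : x ∉ (t : Set X) := fun h => hx ⟨t, t.2, h⟩
  simp [hxt]

theorem measurable_partInfo {ν μ : Measure X} {P : Set (Set X)} (hP : IsMuPartition μ P) :
    Measurable (partInfo ν P) := by
  have := hP.1.to_subtype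
  refine Measurable.iInf fun s => ?_
  have hs := hP.2.1 s s.2
  exact (measurable_const.indicator hs).add (measurable_const.indicator hs.compl)

theorem lintegral_partInfo {ν : Measure X} [IsFiniteMeasure ν] {P : Set (Set X)}
    (hP : IsMuPartition ν P) : ∫⁻ x, partInfo ν P x ∂ν = partEntropy ν P := by
  have := hP.1.to_subtype
  have hae : ∀ᵐ x ∂ν, x ∈ ⋃₀ P := hP.2.2.2
  have hd : Pairwise (Function.onFun Disjoint fun s : P => (s : Set X)) :=
    fun s t hst => hP.2.2.1 s.2 t.2 (Subtype.coe_injective.ne hst)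
  have hrestrict : ∫⁻ x, partInfo ν P x ∂ν = ∫⁻ x in ⋃₀ P, partInfo ν P x ∂ν := by
    rw [Measure.restrict_eq_self_of_ae_mem hae]
  rw [hrestrict, Set.sUnion_eq_iUnion, lintegral_iUnion (fun s : P => hP.2.1 s s.2) hd]
  refine tsum_congr fun s => ?_
  rw [setLIntegral_congr_fun (hP.2.1 s s.2) fun x hx => partInfo_of_mem hP.2.2.1 s.2 hx,
    setLIntegral_const, infoContent_mul_self (measure_ne_top _ _)]

theorem tsum_measure_le_univ {μ ν : Measure X} {P : Set (Set X)} (hP : IsMuPartition μ P) :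
    ∑' s : P, ν s ≤ ν Set.univ := by
  rw [← measure_sUnion hP.1 hP.2.2.1 hP.2.1]
  exact measure_mono (Set.subset_univ _)

theorem partEntropy_range_le {ι : Type*} (μ : Measure X) (A : ι → Set X) :
    partEntropy μ (Set.range A) ≤ ∑' i, ENNReal.ofReal (sh (μ (A i)).toReal) := by
  have h := ENNReal.tsum_comp_le_tsum_of_injective
    (Function.injective_surjInv (Set.rangeFactorization_surjective (f := A)))
    (fun i => ENNReal.ofReal (sh (μ (A i)).toReal))
  refine le_trans (ENNReal.tsum_le_tsum fun s => ?_) h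
  have hs : A (Function.surjInv (Set.rangeFactorization_surjective (f := A)) s) = s :=
    congrArg Subtype.val (Function.surjInv_eq Set.rangeFactorization_surjective s)
  simp only [hs, le_refl]

theorem entropyH_sum_le_sum_partEntropy {n : ℕ} (ν : Fin n → Measure X)
    [∀ k, IsFiniteMeasure (ν k)] (hν : (∑ k, ν k) Set.univ = 1) {Q : Set (Set X)}
    (P : Fin n → Set (Set X)) (hP : ∀ k, IsMuPartition (ν k) (P k)) (hQ : ∀ k, Finer (P k) Q) :
    entropyH (∑ k, ν k) Q ≤ ∑ k, partEntropy (ν k) (P k) := by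
  set μ := ∑ k, ν k with hμ
  rcases eq_or_ne (∑ k, partEntropy (ν k) (P k)) ⊤ with htop | htop
  · exact htop ▸ le_top
  have : Nonempty (Fin n) := by
    by_contra h
    rw [not_nonempty_iff] at h
    simp [hμ] at hν
  have hcount : ∀ k, Countable (P k) := fun k => (hP k).1.to_subtype
  set F : Fin n → X → ℝ≥0∞ := fun k => partInfo (ν k) (P k) with hF
  have hFm : ∀ k, Measurable (F k) := fun k => measurable_partInfo (hP k)
  set G : X → ℝ≥0∞ := fun x => ⨅ k, F k x with hG
  have hGm : Measurable G := Measurable.iInf hFm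
  have hGint : ∫⁻ x, G x ∂μ ≤ ∑ k, partEntropy (ν k) (P k) := by
    rw [hμ, lintegral_finsetSum_measure]
    refine Finset.sum_le_sum fun k _ => ?_
    rw [← lintegral_partInfo (hP k)]
    exact lintegral_mono fun x => iInf_le _ k
  set D : Fin n → Set X := disjointed fun k => {x | F k x = G x} with hD
  have hDm : ∀ k, MeasurableSet (D k) := fun k =>
    disjointedRec (fun _ i ht => ht.diff (measurableSet_eq_fun (hFm i) hGm))
      (measurableSet_eq_fun (hFm k) hGm)
  have hDF : ∀ k, ∀ x ∈ D k, F k x = G x := fun k x hx => disjointed_subset _ k hx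
  have hDcover : ∀ x, ∃ k, x ∈ D k := by
    intro x
    obtain ⟨k, hk⟩ := exists_eq_ciInf_of_finite (f := fun k => F k x)
    have : x ∈ ⋃ k, D k := by
      rw [hD, iUnion_disjointed]
      exact Set.mem_iUnion.2 ⟨k, hk⟩
    exact Set.mem_iUnion.1 this
  set A : (Σ k, P k) → Set X := fun i => (i.2 : Set X) ∩ D i.1 with hA
  have hAm : ∀ i, MeasurableSet (A i) := fun i => ((hP i.1).2.1 _ i.2.2).inter (hDm i.1)
  have hAd : Pairwise (Function.onFun Disjoint A) := by
    rintro ⟨k, s⟩ ⟨l, t⟩ hne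
    rcases eq_or_ne k l with rfl | hkl
    · have hst : (s : Set X) ≠ t := fun h => hne (by rw [Subtype.ext h])
      exact ((hP k).2.2.1 s.2 t.2 hst).mono Set.inter_subset_left Set.inter_subset_left
    · exact (disjoint_disjointed _ hkl).mono Set.inter_subset_right Set.inter_subset_right
  have hAae : ∀ᵐ x ∂μ, x ∈ ⋃ i, A i := by
    filter_upwards [ae_lt_top hGm (ne_top_of_le_ne_top htop hGint)] with x hx
    obtain ⟨k, hk⟩ := hDcover x
    have hxP : x ∈ ⋃₀ P k := by
      by_contra h
      exact hx.ne ((hDF k x hk).symm.trans (partInfo_of_notMem h))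
    obtain ⟨s, hs, hxs⟩ := hxP
    exact Set.mem_iUnion.2 ⟨⟨k, s, hs⟩, hxs, hk⟩
  have hAsum : ∑' i, μ (A i) = 1 := by
    rw [← measure_iUnion hAd hAm, ← hν]
    exact measure_eq_measure_of_null_sdiff (Set.subset_univ _)
      (by rw [← Set.compl_eq_univ_sdiff]; exact hAae)
  have hwsum : ∑' i : Σ k, P k, ν i.1 i.2 ≤ 1 := by
    rw [ENNReal.tsum_sigma', tsum_fintype, ← hν, hμ, Measure.finsetSum_apply]
    exact Finset.sum_le_sum fun k _ => tsum_measure_le_univ (hP k)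
  have hpart : IsMuPartition μ (Set.range A) := by
    refine ⟨Set.countable_range A, ?_, ?_, ?_⟩
    · rintro _ ⟨i, rfl⟩
      exact hAm i
    · rintro _ ⟨i, rfl⟩ _ ⟨j, rfl⟩ hne
      exact hAd fun h => hne (congrArg A h)
    · rw [Set.sUnion_range]
      exact hAae
  have hfine : Finer (Set.range A) Q := by
    rintro _ ⟨i, rfl⟩
    obtain ⟨q, hq, hsq⟩ := hQ i.1 _ i.2.2
    exact ⟨q, hq, Set.inter_subset_left.trans hsq⟩
  calc entropyH μ Q ≤ partEntropy μ (Set.range A) := iInf₂_le_of_le _ hpart (iInf_le _ hfine)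
    _ ≤ ∑' i, ENNReal.ofReal (sh (μ (A i)).toReal) := partEntropy_range_le μ A
    _ ≤ ∑' i : Σ k, P k, infoContent (ν i.1 i.2) * μ (A i) := tsum_ofReal_sh_le hAsum hwsum
    _ = ∑' i, ∫⁻ x in A i, G x ∂μ := by
      refine tsum_congr fun i => ?_
      rw [← setLIntegral_const]
      refine setLIntegral_congr_fun (hAm i) fun x hx => ?_
      exact (partInfo_of_mem (hP i.1).2.2.1 i.2.2 hx.1).symm.trans (hDF i.1 x hx.2)
    _ = ∫⁻ x in ⋃ i, A i, G x ∂μ := (lintegral_iUnion hAm hAd G).symm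
    _ ≤ ∫⁻ x, G x ∂μ := setLIntegral_le_lintegral _ _
    _ ≤ _ := hGint

theorem entropyH_sum_le {n : ℕ} (ν : Fin n → Measure X) [∀ k, IsFiniteMeasure (ν k)]
    (hν : (∑ k, ν k) Set.univ = 1) (Q : Set (Set X)) :
    entropyH (∑ k, ν k) Q ≤ ∑ k, entropyH (ν k) Q := by
  rcases eq_or_ne (∑ k, entropyH (ν k) Q) ⊤ with htop | htop
  · exact htop ▸ le_top
  have hfin : ∀ k, entropyH (ν k) Q ≠ ⊤ := fun k => ENNReal.sum_ne_top.1 htop k (Finset.mem_univ k)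
  have happrox : ∀ ε : ℝ≥0∞, ε ≠ 0 →
      entropyH (∑ k, ν k) Q ≤ ∑ k, (entropyH (ν k) Q + ε) := by
    intro ε hε
    have hex : ∀ k, ∃ P, IsMuPartition (ν k) P ∧ Finer P Q ∧
        partEntropy (ν k) P < entropyH (ν k) Q + ε := by
      intro k
      have h := ENNReal.lt_add_right (hfin k) hε
      nth_rw 1 [entropyH] at h
      simpa only [iInf_lt_iff, exists_prop] using h
    choose P hP hQ hlt using hex
    exact (entropyH_sum_le_sum_partEntropy ν hν P hP hQ).trans
      (Finset.sum_le_sum fun k _ => (hlt k).le)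
  have hlim : Filter.Tendsto (fun ε : ℝ≥0∞ => ∑ k, (entropyH (ν k) Q + ε))
      (nhdsWithin 0 (Set.Ioi 0)) (nhds (∑ k, (entropyH (ν k) Q + 0))) :=
    (Continuous.tendsto (by fun_prop) 0).mono_left nhdsWithin_le_nhds
  simp only [add_zero] at hlim
  refine ge_of_tendsto hlim ?_
  filter_upwards [self_mem_nhdsWithin] with ε hε
  exact happrox ε (ne_of_gt hε)

theorem entropyH_zero (Q : Set (Set X)) : entropyH (0 : Measure X) Q = 0 := by
  refine le_antisymm ?_ bot_le
  refine iInf₂_le_of_le ∅ ⟨Set.countable_empty, by simp, by simp, by simp⟩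
    (iInf_le_of_le (by simp [Finer]) ?_)
  simp [partEntropy]

theorem entropyH_smul_le (μ : Measure X) [IsProbabilityMeasure μ] {a : ℝ} (h0 : 0 ≤ a)
    (h1 : a ≤ 1) (Q : Set (Set X)) :
    entropyH (ENNReal.ofReal a • μ) Q ≤
      ENNReal.ofReal a * entropyH μ Q + ENNReal.ofReal (sh a) := by
  rcases h0.eq_or_lt with rfl | ha
  · simp [entropyH_zero]
  have ha' : ENNReal.ofReal a ≠ 0 := by simpa using ha
  simp only [entropyH, ENNReal.mul_iInf_of_ne ha' ENNReal.ofReal_ne_top, ENNReal.iInf_add]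
  refine iInf_mono fun P => le_iInf fun hP => le_iInf fun hQ => ?_
  refine iInf₂_le_of_le ⟨hP.1, hP.2.1, hP.2.2.1, by simp [hP.2.2.2]⟩ hQ ?_
  calc partEntropy (ENNReal.ofReal a • μ) P
      = ∑' s : P, (ENNReal.ofReal a * ENNReal.ofReal (sh (μ s).toReal) +
          ENNReal.ofReal (sh a) * μ s) := by
        refine tsum_congr fun s => ?_
        have hs1 : (μ s).toReal ≤ 1 := ENNReal.toReal_mono ENNReal.one_ne_top prob_le_one
        have hs0 : 0 ≤ (μ s).toReal := ENNReal.toReal_nonneg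
        rw [Measure.smul_apply, smul_eq_mul, ENNReal.toReal_mul, ENNReal.toReal_ofReal h0,
          sh_mul, ENNReal.ofReal_add (mul_nonneg h0 (sh_nonneg hs0 hs1))
            (mul_nonneg (sh_nonneg h0 h1) hs0), ENNReal.ofReal_mul h0,
          ENNReal.ofReal_mul (sh_nonneg h0 h1), ENNReal.ofReal_toReal (measure_ne_top _ _)]
    _ = ENNReal.ofReal a * partEntropy μ P + ENNReal.ofReal (sh a) * ∑' s : P, μ s := by
        rw [ENNReal.tsum_add, ENNReal.tsum_mul_left, ENNReal.tsum_mul_left, partEntropy]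
    _ ≤ ENNReal.ofReal a * partEntropy μ P + ENNReal.ofReal (sh a) := by
        gcongr
        refine mul_le_of_le_one_right' ?_
        exact (tsum_measure_le_univ hP).trans_eq measure_univ

theorem entropyH_mixture_le {n : ℕ} (a : Fin n → ℝ) (ha : ∀ k, a k ∈ Set.Icc (0 : ℝ) 1)
    (hsum : ∑ k, a k = 1) (μ : Fin n → Measure X) [∀ k, IsProbabilityMeasure (μ k)]
    (Q : Set (Set X)) :
    entropyH (∑ k, ENNReal.ofReal (a k) • μ k) Q ≤
      ∑ k, ENNReal.ofReal (a k) * entropyH (μ k) Q + ∑ k, ENNReal.ofReal (sh (a k)) := by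
  have : ∀ k, IsFiniteMeasure (ENNReal.ofReal (a k) • μ k) := fun k =>
    (μ k).smul_finite ENNReal.ofReal_ne_top
  have huniv : (∑ k, ENNReal.ofReal (a k) • μ k) Set.univ = 1 := by
    rw [Measure.finsetSum_apply]
    simp [← ENNReal.ofReal_sum_of_nonneg fun k _ => (ha k).1, hsum]
  rw [← Finset.sum_add_distrib]
  exact (entropyH_sum_le _ huniv Q).trans
    (Finset.sum_le_sum fun k _ => entropyH_smul_le (μ k) (ha k).1 (ha k).2 Q)

end Mixture

theorem ENNReal.limsup_add_le_add_limsup {α : Type*} {l : Filter α} (u v : α → ℝ≥0∞) :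
    Filter.limsup (fun x => u x + v x) l ≤ Filter.limsup u l + Filter.limsup v l := by
  refine ENNReal.le_of_forall_pos_le_add fun ε hε hfin => ?_
  have hε2 : (ε : ℝ≥0∞) / 2 ≠ 0 := by simpa using hε.ne'
  obtain ⟨hu, hv⟩ := ENNReal.add_lt_top.1 hfin
  have hu' := Filter.eventually_lt_of_limsup_lt (ENNReal.lt_add_right hu.ne hε2)
  have hv' := Filter.eventually_lt_of_limsup_lt (ENNReal.lt_add_right hv.ne hε2)
  refine Filter.limsup_le_of_le (h := ?_)
  filter_upwards [hu', hv'] with x hux hvx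
  calc u x + v x ≤ Filter.limsup u l + ε / 2 + (Filter.limsup v l + ε / 2) :=
        add_le_add hux.le hvx.le
    _ = Filter.limsup u l + Filter.limsup v l + (ε / 2 + ε / 2) := by ring
    _ = _ := by rw [ENNReal.add_halves]

theorem ENNReal.limsup_sum_mul_le {α ι : Type*} {l : Filter α} (s : Finset ι)
    {c : ι → ℝ≥0∞} (hc : ∀ k, c k ≠ ⊤) (u : ι → α → ℝ≥0∞) :
    Filter.limsup (fun x => ∑ k ∈ s, c k * u k x) l ≤
      ∑ k ∈ s, c k * Filter.limsup (u k) l := by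
  classical
  induction s using Finset.induction_on with
  | empty =>
    simp only [Finset.sum_empty]
    exact Filter.limsup_const_bot.le
  | insert k s hk ih =>
    simp only [Finset.sum_insert hk]
    refine (ENNReal.limsup_add_le_add_limsup _ _).trans (add_le_add ?_ ih)
    rw [ENNReal.limsup_const_mul_of_ne_top (hc k)]

theorem tendsto_ofReal_neg_logb_nhdsGT_zero :
    Filter.Tendsto (fun δ : ℝ => ENNReal.ofReal (-Real.logb 2 δ)) (nhdsWithin 0 (Set.Ioi 0))
      (nhds ⊤) :=
  ENNReal.tendsto_ofReal_nhds_top.2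
    (Filter.tendsto_neg_atBot_atTop.comp (Real.tendsto_logb_nhdsGT_zero one_lt_two))

/-- second inequality of Theorem 3 of the paper: the upper entropy dimension
of a finite mixture satisfies `udim_E(Σ_k a_k μ_k) ≤ Σ_k a_k udim_E(μ_k)`. -/
theorem udimE_mixture_le {X : Type*} [MetricSpace X] [MeasurableSpace X] [BorelSpace X]
    (n : ℕ) (a : Fin n → ℝ) (ha : ∀ k, a k ∈ Set.Icc (0 : ℝ) 1) (hsum : ∑ k, a k = 1)
    (μ : Fin n → Measure X) (hμ : ∀ k, IsProbabilityMeasure (μ k)) :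
    udimE (∑ k, ENNReal.ofReal (a k) • μ k) ≤
      ∑ k, ENNReal.ofReal (a k) * udimE (μ k) := by
  set C : ℝ≥0∞ := ∑ k, ENNReal.ofReal (sh (a k)) with hC
  have hC_top : C ≠ ⊤ := ENNReal.sum_ne_top.2 fun k _ => ENNReal.ofReal_ne_top
  have hlim : Filter.limsup (fun δ : ℝ => C / ENNReal.ofReal (-Real.logb 2 δ))
      (nhdsWithin 0 (Set.Ioi 0)) = 0 := by
    have h := ENNReal.Tendsto.const_div tendsto_ofReal_neg_logb_nhdsGT_zero (Or.inr hC_top)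
    rw [ENNReal.div_top] at h
    exact h.limsup_eq
  calc udimE (∑ k, ENNReal.ofReal (a k) • μ k)
      ≤ Filter.limsup (fun δ : ℝ => (∑ k, ENNReal.ofReal (a k) *
          (entropyH (μ k) (ballFam X δ) / ENNReal.ofReal (-Real.logb 2 δ))) +
          C / ENNReal.ofReal (-Real.logb 2 δ)) (nhdsWithin 0 (Set.Ioi 0)) := by
        refine Filter.limsup_le_limsup (Filter.Eventually.of_forall fun δ => ?_)
        refine (ENNReal.div_le_div_right (entropyH_mixture_le a ha hsum μ _) _).trans_eq ?_
        simp only [div_eq_mul_inv, add_mul, Finset.sum_mul, mul_assoc, hC]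
    _ ≤ (∑ k, ENNReal.ofReal (a k) * udimE (μ k)) + 0 := by
        rw [← hlim]
        exact (ENNReal.limsup_add_le_add_limsup _ _).trans
          (add_le_add_left (ENNReal.limsup_sum_mul_le _ (fun _ => ENNReal.ofReal_ne_top) _) _)
    _ = _ := add_zero _
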